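/- Let n ≥ 1 and let f be a Gaussian random field on ℝ with mean function m and covariance function k such that m is n times differentiable and k is 2n times continuously differentiable. Then there exists a sequence of real-valued random fields g₀, g₁, …, g_n on ℝ with g₀ = f such that for each 0 ≤ i < n and each x ∈ ℝ, (g_i(x+δ) − g_i(x))/δ → g_{i+1}(x) in L²(Ω) as δ → 0, and each g_i (0 ≤ i ≤ n) is a Gaussian random field on ℝ. (Thus the iterated derivative random fields Df = g₁, D²f = g₂, …, Dⁿf = g_n are well-defined Gaussian random fields.) -/

import Mathlib

open MeasureTheory ProbabilityTheory Filter Topology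
open scoped NNReal

/-- A real random variable has a (possibly degenerate) Gaussian distribution. -/
def IsGaussianRV {Ω : Type*} [MeasurableSpace Ω] (P : Measure Ω) (ξ : Ω → ℝ) : Prop :=
  Measurable ξ ∧ ∃ (μ : ℝ) (v : ℝ≥0), Measure.map ξ P = gaussianReal μ v

/-- A Gaussian random field on a set `X`: every finite linear combination of its
values is a (possibly degenerate) Gaussian random variable. -/
def IsGaussianRF {Ω : Type*} [MeasurableSpace Ω] (P : Measure Ω) {X : Type*}
    (f : X → Ω → ℝ) : Prop :=
  (∀ x, Measurable (f x)) ∧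
  ∀ (p : ℕ) (x : Fin p → X) (c : Fin p → ℝ),
    IsGaussianRV P (fun ω => ∑ i, c i * f (x i) ω)

/-- `Df` is the derivative random field of `f`: at every point, the difference
quotients of `f` converge to `Df` in mean square. -/
def IsDerivField {Ω : Type*} [MeasurableSpace Ω] (P : Measure Ω)
    (f Df : ℝ → Ω → ℝ) : Prop :=
  (∀ x, Measurable (Df x)) ∧
  ∀ x : ℝ, Tendsto (fun δ : ℝ => ∫ ω, ((f (x + δ) ω - f x ω) / δ - Df x ω) ^ 2 ∂P)
    (𝓝[≠] 0) (𝓝 0)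

open scoped InnerProductSpace ENNReal

section HilbertCurve

/-- Second differences of a function of two variables are approximated by its mixed derivative. -/
lemma exists_abs_second_difference_sub_le {K K₁ M : ℝ → ℝ → ℝ}
    (hK : ∀ s t, HasDerivAt (fun s => K s t) (K₁ s t) s)
    (hK₁ : ∀ s t, HasDerivAt (fun t => K₁ s t) (M s t) t) {x : ℝ}
    (hM : ContinuousAt (fun p : ℝ × ℝ => M p.1 p.2) (x, x)) {ε : ℝ} (hε : 0 < ε) :
    ∃ r > 0, ∀ a b : ℝ, |a| < r → |b| < r →
      |K (x + a) (x + b) - K (x + a) x - K x (x + b) + K x x - a * b * M x x|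
        ≤ ε * |a| * |b| := by
  obtain ⟨r, hr, h⟩ := Metric.continuousAt_iff.1 hM ε hε
  refine ⟨r, hr, fun a b ha hb => ?_⟩
  have mem : ∀ {c : ℝ}, |c| < r → x + c ∈ Metric.ball x r := fun hc => by
    simpa [Metric.mem_ball, Real.dist_eq] using hc
  have hx : x ∈ Metric.ball x r := Metric.mem_ball_self hr
  have h₁ : ∀ s ∈ Metric.ball x r,
      ‖(K₁ s (x + b) - M x x * (x + b)) - (K₁ s x - M x x * x)‖ ≤ ε * ‖x + b - x‖ := by
    intro s hs
    refine (convex_ball x r).norm_image_sub_le_of_norm_hasDerivWithin_le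
      (f := fun t => K₁ s t - M x x * t) (f' := fun t => M s t - M x x)
      (fun t _ => ?_) (fun t ht => ?_) hx (mem hb)
    · have := (hK₁ s t).sub ((hasDerivAt_id t).const_mul (M x x))
      rw [mul_one] at this
      exact this.hasDerivWithinAt
    · have := @h (s, t) (by simpa [Prod.dist_eq] using ⟨hs, ht⟩)
      exact this.le
  have h₂ := (convex_ball x r).norm_image_sub_le_of_norm_hasDerivWithin_le
      (f := fun s => K s (x + b) - K s x - b * M x x * s)
      (f' := fun s => K₁ s (x + b) - K₁ s x - b * M x x) (C := ε * ‖x + b - x‖)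
      (fun s _ => by
        have := ((hK s (x + b)).sub (hK s x)).sub ((hasDerivAt_id s).const_mul (b * M x x))
        rw [mul_one] at this
        exact this.hasDerivWithinAt)
      (fun s hs => by
        refine le_of_eq_of_le ?_ (h₁ s hs)
        congr 1
        ring) hx (mem ha)
  simp only [Real.norm_eq_abs, add_sub_cancel_left] at h₂
  calc _ = |K (x + a) (x + b) - K (x + a) x - b * M x x * (x + a) -
        (K x (x + b) - K x x - b * M x x * x)| := by congr 1; ring
    _ ≤ _ := h₂.trans_eq (by ring)

variable {H : Type*} [NormedAddCommGroup H] [InnerProductSpace ℝ H]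

/-- A curve in a Hilbert space whose Gram kernel has a continuous mixed second derivative is
differentiable. -/
lemma differentiableAt_of_gram_mixed_deriv [CompleteSpace H] {F : ℝ → H} {K₁ M : ℝ → ℝ → ℝ}
    (hK : ∀ s t, HasDerivAt (fun s => ⟪F s, F t⟫_ℝ) (K₁ s t) s)
    (hK₁ : ∀ s t, HasDerivAt (fun t => K₁ s t) (M s t) t) {x : ℝ}
    (hM : ContinuousAt (fun p : ℝ × ℝ => M p.1 p.2) (x, x)) :
    DifferentiableAt ℝ F x := by
  set D : ℝ → H := fun h => h⁻¹ • (F (x + h) - F x) with hD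
  suffices hC : Cauchy (map D (𝓝[≠] 0)) by
    obtain ⟨L, hL⟩ := cauchy_map_iff_exists_tendsto.1 hC
    exact (hasDerivAt_iff_tendsto_slope_zero.2 hL).differentiableAt
  refine Metric.cauchy_iff.2 ⟨inferInstance, fun η hη => ?_⟩
  obtain ⟨r, hr, h⟩ := exists_abs_second_difference_sub_le
    (K := fun s t => ⟪F s, F t⟫_ℝ) hK hK₁ hM (ε := η ^ 2 / 5) (by positivity)
  have key : ∀ a b : ℝ, a ≠ 0 → b ≠ 0 → |a| < r → |b| < r →
      |⟪D a, D b⟫_ℝ - M x x| ≤ η ^ 2 / 5 := by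
    intro a b ha0 hb0 ha hb
    have h' := h a b ha hb
    have e : ⟪D a, D b⟫_ℝ - M x x = (⟪F (x + a), F (x + b)⟫_ℝ - ⟪F (x + a), F x⟫_ℝ
        - ⟪F x, F (x + b)⟫_ℝ + ⟪F x, F x⟫_ℝ - a * b * M x x) / (a * b) := by
      simp only [hD, inner_smul_left, inner_smul_right, inner_sub_left, inner_sub_right]
      simp only [conj_trivial]
      field_simp
      ring
    rw [e, abs_div, abs_mul, div_le_iff₀ (by positivity)]
    linarith
  refine ⟨D '' {a | a ≠ 0 ∧ |a| < r}, image_mem_map ?_, ?_⟩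
  · have : {a : ℝ | |a| < r} ∈ 𝓝 (0 : ℝ) := by
      filter_upwards [Metric.ball_mem_nhds (0 : ℝ) hr] with a ha
      simpa [Real.dist_eq] using ha
    filter_upwards [self_mem_nhdsWithin, mem_nhdsWithin_of_mem_nhds this] with a h1 h2
    exact ⟨h1, h2⟩
  · rintro _ ⟨a, ⟨ha0, ha⟩, rfl⟩ _ ⟨b, ⟨hb0, hb⟩, rfl⟩
    rw [dist_eq_norm]
    refine lt_of_pow_lt_pow_left₀ 2 hη.le ?_
    rw [norm_sub_sq_real, ← real_inner_self_eq_norm_sq, ← real_inner_self_eq_norm_sq]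
    have h1 := abs_le.1 (key a a ha0 ha0 ha ha)
    have h2 := abs_le.1 (key a b ha0 hb0 ha hb)
    have h3 := abs_le.1 (key b b hb0 hb0 hb hb)
    have : 0 < η ^ 2 := by positivity
    linarith [h1.2, h2.1, h3.2]

/-- A curve in a Hilbert space whose Gram kernel is of class `C^{2n}` is `n` times
differentiable. -/
lemma differentiable_iteratedDeriv_of_contDiff_gram [CompleteSpace H] (n : ℕ) (F : ℝ → H)
    (hF : ContDiff ℝ (2 * n : ℕ) (fun p : ℝ × ℝ => ⟪F p.1, F p.2⟫_ℝ)) :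
    ∀ i < n, Differentiable ℝ (iteratedDeriv i F) := by
  induction n generalizing F with
  | zero => intro i hi; omega
  | succ n ih =>
    set κ : ℝ × ℝ → ℝ := fun p => ⟪F p.1, F p.2⟫_ℝ with hκ
    set κ₁ : ℝ × ℝ → ℝ := fun p => fderiv ℝ κ p (1, 0) with hκ₁
    set κ₂ : ℝ × ℝ → ℝ := fun p => fderiv ℝ κ₁ p (0, 1) with hκ₂
    have c₁ : ContDiff ℝ (2 * n + 1 : ℕ) κ₁ := by
      refine ContDiff.clm_apply (hF.fderiv_right (m := (2 * n + 1 : ℕ)) ?_) contDiff_const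
      norm_cast
    have c₂ : ContDiff ℝ (2 * n : ℕ) κ₂ := by
      refine ContDiff.clm_apply (c₁.fderiv_right (m := (2 * n : ℕ)) ?_) contDiff_const
      norm_cast
    have d₁ : ∀ s t, HasDerivAt (fun s => ⟪F s, F t⟫_ℝ) (κ₁ (s, t)) s := by
      intro s t
      have hd : HasFDerivAt κ (fderiv ℝ κ (s, t)) (s, t) :=
        (hF.differentiable (by norm_cast) (s, t)).hasFDerivAt
      exact hd.comp_hasDerivAt s ((hasDerivAt_id s).prodMk (hasDerivAt_const s t))
    have d₂ : ∀ s t, HasDerivAt (fun t => κ₁ (s, t)) (κ₂ (s, t)) t := by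
      intro s t
      have hd : HasFDerivAt κ₁ (fderiv ℝ κ₁ (s, t)) (s, t) :=
        (c₁.differentiable (by norm_cast) (s, t)).hasFDerivAt
      exact hd.comp_hasDerivAt t ((hasDerivAt_const t s).prodMk (hasDerivAt_id t))
    have hd : Differentiable ℝ F := fun x =>
      differentiableAt_of_gram_mixed_deriv (K₁ := fun s t => κ₁ (s, t))
        (M := fun s t => κ₂ (s, t)) d₁ d₂ c₂.continuous.continuousAt
    have e₁ : ∀ s t, κ₁ (s, t) = ⟪deriv F s, F t⟫_ℝ := fun s t => by
      have := (hd s).hasDerivAt.inner ℝ (hasDerivAt_const s (F t))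
      simpa using (d₁ s t).unique this
    have e₂ : ∀ s t, κ₂ (s, t) = ⟪deriv F s, deriv F t⟫_ℝ := fun s t => by
      have := (hasDerivAt_const t (deriv F s)).inner ℝ (hd t).hasDerivAt
      have h' := d₂ s t
      simp only [e₁] at h'
      simpa using h'.unique this
    have ih' := ih (deriv F) (by
      convert c₂ using 1
      exact funext fun p => (e₂ p.1 p.2).symm)
    intro i hi
    cases i with
    | zero => simpa using hd
    | succ i =>
      rw [iteratedDeriv_succ']
      exact ih' i (by omega)

end HilbertCurve

section GaussianL2

variable {Ω : Type*} [MeasurableSpace Ω] {P : Measure Ω}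

lemma norm_sq_eq_integral_sq (X : Lp ℝ 2 P) : ‖X‖ ^ 2 = ∫ ω, X ω ^ 2 ∂P := by
  rw [← real_inner_self_eq_norm_sq, L2.inner_def]
  simp [pow_two]

lemma IsGaussianRV.memLp_two {ξ : Ω → ℝ} (h : IsGaussianRV P ξ) : MemLp ξ 2 P := by
  obtain ⟨hξ, μ, v, hμv⟩ := h
  have := memLp_id_gaussianReal (μ := μ) (v := v) 2
  rw [← hμv, memLp_map_measure_iff (by fun_prop) hξ.aemeasurable] at this
  exact this

lemma sum_smul_coeFn {X : Type*} {f : X → Ω → ℝ} {A : X → Lp ℝ 2 P}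
    (h : ∀ x, f x =ᵐ[P] A x) (p : ℕ) (x : Fin p → X) (c : Fin p → ℝ) :
    (fun ω => ∑ i, c i * f (x i) ω) =ᵐ[P] ((∑ i, c i • A (x i) : Lp ℝ 2 P) : Ω → ℝ) := by
  have h1 : ∀ᵐ ω ∂P, ∀ i, (c i • A (x i) : Lp ℝ 2 P) ω = c i * f (x i) ω := by
    refine ae_all_iff.2 fun i => ?_
    filter_upwards [Lp.coeFn_smul (c i) (A (x i)), h (x i)] with ω h1 h2
    rw [h1, h2]; rfl
  filter_upwards [Lp.coeFn_finsetSum Finset.univ fun i => c i • A (x i), h1] with ω h2 h3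
  rw [h2]
  simp [h3]

lemma isDerivField_of_hasDerivAt {f Df : ℝ → Ω → ℝ} {A A' : ℝ → Lp ℝ 2 P}
    (hDf : ∀ x, Measurable (Df x)) (hA : ∀ x, f x =ᵐ[P] A x) (hA' : ∀ x, Df x =ᵐ[P] A' x)
    (h : ∀ x, HasDerivAt A (A' x) x) : IsDerivField P f Df := by
  refine ⟨hDf, fun x => ?_⟩
  have hlim := (((hasDerivAt_iff_tendsto_slope_zero.1 (h x)).sub_const (A' x)).norm).pow 2
  simp only [sub_self, norm_zero, ne_eq, OfNat.ofNat_ne_zero, not_false_eq_true, zero_pow] at hlim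
  refine hlim.congr fun δ => ?_
  rw [norm_sq_eq_integral_sq]
  refine integral_congr_ae ?_
  filter_upwards [hA (x + δ), hA x, hA' x, Lp.coeFn_sub (δ⁻¹ • (A (x + δ) - A x)) (A' x),
    Lp.coeFn_smul δ⁻¹ (A (x + δ) - A x), Lp.coeFn_sub (A (x + δ)) (A x)] with ω h1 h2 h3 h4 h5 h6
  rw [h4, Pi.sub_apply, h5, Pi.smul_apply, h6, Pi.sub_apply, h1, h2, h3, smul_eq_mul,
    inv_mul_eq_div]

variable (P) [IsProbabilityMeasure P]

/-- The constant random variable `1` as an element of `L²`. -/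
noncomputable def oneL2 : Lp ℝ 2 P :=
  indicatorConstLp 2 MeasurableSet.univ (measure_ne_top P Set.univ) (1 : ℝ)

lemma coeFn_oneL2 : (oneL2 P : Ω → ℝ) =ᵐ[P] fun _ => 1 := by
  simpa [oneL2] using indicatorConstLp_coeFn (p := 2) (hs := MeasurableSet.univ)
    (hμs := measure_ne_top P Set.univ) (c := (1 : ℝ))

lemma norm_oneL2 : ‖oneL2 P‖ = 1 := by
  rw [oneL2, norm_indicatorConstLp two_ne_zero ENNReal.ofNat_ne_top]
  simp

variable {P}

lemma inner_oneL2 (X : Lp ℝ 2 P) : ⟪oneL2 P, X⟫_ℝ = ∫ ω, X ω ∂P := by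
  simpa [oneL2] using L2.inner_indicatorConstLp_one (𝕜 := ℝ) MeasurableSet.univ
    (measure_ne_top P Set.univ) X

lemma integrable_coeFn_L2 (X : Lp ℝ 2 P) : Integrable X P :=
  (Lp.memLp X).integrable one_le_two

lemma integral_abs_le_norm (X : Lp ℝ 2 P) : ∫ ω, |X ω| ∂P ≤ ‖X‖ := by
  have h : ∫ ω, |X ω| ∂P = ⟪oneL2 P, |X|⟫_ℝ := by
    rw [inner_oneL2]
    exact integral_congr_ae ((Lp.coeFn_abs X).mono fun ω h => h.symm)
  rw [h]
  refine (real_inner_le_norm _ _).trans ?_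
  rw [norm_oneL2, norm_abs_eq_norm, one_mul]

lemma integral_sq_le_norm_sq (X : Lp ℝ 2 P) : (∫ ω, X ω ∂P) ^ 2 ≤ ‖X‖ ^ 2 := by
  rw [sq_le_sq, abs_norm, ← inner_oneL2]
  simpa [norm_oneL2] using abs_real_inner_le_norm (oneL2 P) X

lemma norm_cexp_mul_I_sub_le (a b : ℝ) :
    ‖Complex.exp (a * Complex.I) - Complex.exp (b * Complex.I)‖ ≤ |a - b| := by
  have h : Complex.exp (a * Complex.I) - Complex.exp (b * Complex.I) =
      Complex.exp (b * Complex.I) * (Complex.exp (Complex.I * (a - b : ℝ)) - 1) := by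
    rw [mul_sub, ← Complex.exp_add]
    congr 2
    · push_cast; ring
    · ring
  rw [h, norm_mul, Complex.norm_exp_ofReal_mul_I, one_mul]
  exact Real.norm_exp_I_mul_ofReal_sub_one_le

lemma integrable_cexp_mul_I {ξ : Ω → ℝ} (hξ : AEStronglyMeasurable ξ P) (t : ℝ) :
    Integrable (fun ω => Complex.exp ((t * ξ ω : ℝ) * Complex.I)) P := by
  refine (integrable_const (1 : ℝ)).mono' ?_ (ae_of_all _ fun ω => ?_)
  · have : Continuous fun y : ℝ => Complex.exp ((t * y : ℝ) * Complex.I) := by fun_prop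
    exact this.comp_aestronglyMeasurable hξ
  · rw [Complex.norm_exp_ofReal_mul_I]

lemma continuous_integral_cexp (t : ℝ) :
    Continuous fun X : Lp ℝ 2 P => ∫ ω, Complex.exp ((t * X ω : ℝ) * Complex.I) ∂P := by
  refine (LipschitzWith.of_dist_le_mul (K := ‖t‖₊) fun X Y => ?_).continuous
  rw [dist_eq_norm, dist_eq_norm, ← integral_sub
    (integrable_cexp_mul_I (Lp.aestronglyMeasurable X) t)
    (integrable_cexp_mul_I (Lp.aestronglyMeasurable Y) t)]
  calc _ ≤ ∫ ω, |t| * |(X - Y : Lp ℝ 2 P) ω| ∂P := by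
        refine norm_integral_le_of_norm_le ((integrable_coeFn_L2 (X - Y)).abs.const_mul _) ?_
        filter_upwards [Lp.coeFn_sub X Y] with ω h
        refine (norm_cexp_mul_I_sub_le _ _).trans_eq ?_
        rw [h, Pi.sub_apply, ← mul_sub, abs_mul]
    _ = |t| * ∫ ω, |(X - Y : Lp ℝ 2 P) ω| ∂P := integral_const_mul _ _
    _ ≤ _ := by
        simpa using mul_le_mul_of_nonneg_left (integral_abs_le_norm (X - Y)) (abs_nonneg t)

variable (P) in
/-- The elements of `L²` whose characteristic function is that of a Gaussian variable. -/
def gaussianL2 : Set (Lp ℝ 2 P) :=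
  {X | ∀ t : ℝ, ∫ ω, Complex.exp ((t * X ω : ℝ) * Complex.I) ∂P =
    Complex.exp (t * (∫ ω, X ω ∂P : ℝ) * Complex.I -
      (‖X‖ ^ 2 - (∫ ω, X ω ∂P) ^ 2 : ℝ) * t ^ 2 / 2)}

lemma isClosed_gaussianL2 : IsClosed (gaussianL2 P) := by
  simp only [gaussianL2, Set.ofPred_forall]
  refine isClosed_iInter fun t => isClosed_eq (continuous_integral_cexp t) ?_
  simp only [← inner_oneL2]
  fun_prop

lemma isGaussianRV_iff_mem_gaussianL2 {X : Lp ℝ 2 P} {ξ : Ω → ℝ} (hξ : Measurable ξ)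
    (h : ξ =ᵐ[P] X) : IsGaussianRV P ξ ↔ X ∈ gaussianL2 P := by
  have hchar : ∀ t : ℝ, charFun (Measure.map ξ P) t =
      ∫ ω, Complex.exp ((t * X ω : ℝ) * Complex.I) ∂P := fun t => by
    rw [charFun_apply_real, integral_map hξ.aemeasurable (by fun_prop)]
    refine integral_congr_ae ?_
    filter_upwards [h] with ω hω
    rw [hω]; push_cast; rfl
  have hmean : ∫ ω, X ω ∂P = ∫ ω, ξ ω ∂P := (integral_congr_ae h).symm
  constructor
  · rintro ⟨-, μ, v, hμv⟩ t
    have h1 : ∫ ω, ξ ω ∂P = μ := by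
      have := integral_map (μ := P) hξ.aemeasurable (f := fun y : ℝ => y) (by fun_prop)
      rw [← this, hμv, integral_id_gaussianReal]
    have h2 : ‖X‖ ^ 2 - (∫ ω, X ω ∂P) ^ 2 = v := by
      have hv : Var[X; P] = v := by
        rw [← variance_congr h, ← variance_fun_id_gaussianReal (μ := μ) (v := v), ← hμv,
          variance_map (by fun_prop) hξ.aemeasurable]
        rfl
      rw [← hv, variance_eq_sub (Lp.memLp X), norm_sq_eq_integral_sq]
      rfl
    rw [← hchar, hμv, charFun_gaussianReal, h2, hmean, h1]
  · intro hX
    obtain ⟨v, hv⟩ : ∃ v : ℝ≥0, (v : ℝ) = ‖X‖ ^ 2 - (∫ ω, X ω ∂P) ^ 2 :=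
      ⟨⟨_, sub_nonneg.2 (integral_sq_le_norm_sq X)⟩, rfl⟩
    refine ⟨hξ, ∫ ω, X ω ∂P, v, ?_⟩
    have := Measure.isProbabilityMeasure_map (μ := P) hξ.aemeasurable
    refine Measure.ext_of_charFun (funext fun t => ?_)
    rw [hchar, hX t, charFun_gaussianReal, ← hv]

/-- A random field in `L²` is Gaussian iff the span of its values consists of Gaussian variables. -/
lemma isGaussianRF_iff_span_subset {X : Type*} {f : X → Ω → ℝ} {A : X → Lp ℝ 2 P}
    (hf : ∀ x, Measurable (f x)) (h : ∀ x, f x =ᵐ[P] A x) :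
    IsGaussianRF P f ↔ (Submodule.span ℝ (Set.range A) : Set (Lp ℝ 2 P)) ⊆ gaussianL2 P := by
  have key : ∀ (p : ℕ) (x : Fin p → X) (c : Fin p → ℝ),
      IsGaussianRV P (fun ω => ∑ i, c i * f (x i) ω) ↔
        (∑ i, c i • A (x i) : Lp ℝ 2 P) ∈ gaussianL2 P := fun p x c =>
    isGaussianRV_iff_mem_gaussianL2
      (Finset.measurable_sum _ fun i _ => (hf (x i)).const_mul (c i)) (sum_smul_coeFn h p x c)
  constructor
  · rintro ⟨-, hG⟩ Y hY
    obtain ⟨p, c, y, rfl⟩ := Submodule.mem_span_set'.1 hY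
    choose x hx using fun i => (y i).2
    simpa only [hx] using (key p x c).1 (hG p x c)
  · intro hS
    refine ⟨hf, fun p x c => (key p x c).2 (hS ?_)⟩
    exact Submodule.sum_mem _ fun i _ =>
      Submodule.smul_mem _ _ (Submodule.subset_span ⟨x i, rfl⟩)

end GaussianL2

/-- Iterated derivative random fields up to order `n` are well-defined and Gaussian,
when `m` is `n` times differentiable and `k` is `2n` times continuously differentiable. -/
theorem statement10 {Ω : Type*} [MeasurableSpace Ω] (P : Measure Ω) [IsProbabilityMeasure P]
    (n : ℕ) (hn : 1 ≤ n)
    (f : ℝ → Ω → ℝ) (m : ℝ → ℝ) (k : ℝ → ℝ → ℝ)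
    (hf : IsGaussianRF P f)
    (hm : ∀ x, m x = ∫ ω, f x ω ∂P)
    (hk : ∀ x x', k x x' = ∫ ω, (f x ω - m x) * (f x' ω - m x') ∂P)
    (hmd : ∀ i < n, Differentiable ℝ (iteratedDeriv i m))
    (hkd : ContDiff ℝ (2 * n : ℕ) (fun p : ℝ × ℝ => k p.1 p.2)) :
    ∃ g : ℕ → ℝ → Ω → ℝ, g 0 = f ∧
      (∀ i < n, IsDerivField P (g i) (g (i + 1))) ∧
      (∀ i ≤ n, IsGaussianRF P (g i)) := by
  have hrv : ∀ x, IsGaussianRV P (f x) := fun x => by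
    simpa using hf.2 1 (fun _ => x) (fun _ => 1)
  have hL : ∀ x, MemLp (f x) 2 P := fun x => (hrv x).memLp_two
  set F : ℝ → Lp ℝ 2 P := fun x => (hL x).toLp - m x • oneL2 P with hF
  have hFae : ∀ x, F x =ᵐ[P] fun ω => f x ω - m x := fun x => by
    filter_upwards [Lp.coeFn_sub (hL x).toLp (m x • oneL2 P), (hL x).coeFn_toLp,
      Lp.coeFn_smul (m x) (oneL2 P), coeFn_oneL2 P] with ω h1 h2 h3 h4
    rw [h1, Pi.sub_apply, h2, h3, Pi.smul_apply, h4, smul_eq_mul, mul_one]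
  have hgram : (fun p : ℝ × ℝ => ⟪F p.1, F p.2⟫_ℝ) = fun p => k p.1 p.2 := by
    funext p
    rw [hk, L2.inner_def]
    refine integral_congr_ae ?_
    filter_upwards [hFae p.1, hFae p.2] with ω h1 h2
    rw [h1, h2]
    simp [mul_comm]
  have hFd := differentiable_iteratedDeriv_of_contDiff_gram n F (hgram ▸ hkd)
  set A : ℕ → ℝ → Lp ℝ 2 P := fun i x => iteratedDeriv i F x + iteratedDeriv i m x • oneL2 P
    with hA
  have hA0 : ∀ x, A 0 x = (hL x).toLp := fun x => by simp [hA, hF]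
  have hAd : ∀ i < n, ∀ x, HasDerivAt (A i) (A (i + 1) x) x := fun i hi x => by
    simp only [hA, iteratedDeriv_succ]
    exact (hFd i hi x).hasDerivAt.add ((hmd i hi x).hasDerivAt.smul_const (oneL2 P))
  set g : ℕ → ℝ → Ω → ℝ := fun i => Nat.casesOn i f fun j x => A (j + 1) x with hg
  have hgm : ∀ i x, Measurable (g i x) := fun i x => by
    cases i with
    | zero => exact hf.1 x
    | succ i => exact (Lp.stronglyMeasurable _).measurable
  have hgA : ∀ i x, g i x =ᵐ[P] A i x := fun i x => by
    cases i with
    | zero => rw [hA0]; exact (hL x).coeFn_toLp.symm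
    | succ i => exact Filter.EventuallyEq.rfl
  set S : Submodule ℝ (Lp ℝ 2 P) := (Submodule.span ℝ (Set.range (A 0))).topologicalClosure
    with hS
  have hSG : (S : Set (Lp ℝ 2 P)) ⊆ gaussianL2 P :=
    closure_minimal ((isGaussianRF_iff_span_subset (hgm 0) (hgA 0)).1 hf) isClosed_gaussianL2
  have hAS : ∀ i ≤ n, Submodule.span ℝ (Set.range (A i)) ≤ S := by
    intro i
    induction i with
    | zero => exact fun _ => Submodule.le_topologicalClosure _
    | succ i ih =>
      intro hi
      rw [Submodule.span_le]
      rintro _ ⟨x, rfl⟩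
      have h1 := range_deriv_subset_closure_span_image (A i) dense_univ ⟨x, rfl⟩
      rw [(hAd i (by omega) x).deriv, Set.image_univ] at h1
      exact closure_minimal (ih (by omega)) (Submodule.isClosed_topologicalClosure _) h1
  refine ⟨g, rfl, fun i hi => ?_, fun i hi => ?_⟩
  · exact isDerivField_of_hasDerivAt (hgm (i + 1)) (hgA i) (hgA (i + 1)) (hAd i hi)
  · exact (isGaussianRF_iff_span_subset (hgm i) (hgA i)).2
      (Set.Subset.trans (hAS i hi) hSG)
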